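/- Let F_5 be the field with 5 elements, let r ≥ 1, and fix a nonzero vector w ∈ F_5^r. Let F_1 be the family of all r-element subsets of F_5^r \ {0} that are bases of F_5^r, and let F_2 be the family of all (r−1)-element subsets B of F_5^r \ {0} such that B ∪ {w} is a basis of F_5^r. Then F_1 ∪ F_2 does not contain a copy of the layers i and i−1 of a Q_6 for any 2 ≤ i ≤ 5 (on the ground set F_5^r \ {0}). -/

import Mathlib

/-- `F` contains a copy of the layers `i` and `i-1` of a `Q_6` (for some `2 ≤ i ≤ 5`) on the
ground set `V`, inside the `(r-1)`st and `r`th layers: there are `X ⊆ V` of size 6 and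
`Y ⊆ V \ X` with `|Y| = r - i`, such that `Y ∪ A ∈ F` for every `A ⊆ X` with
`|A| = i - 1` or `|A| = i`. -/
def ContainsQ6LayersOn {α : Type*} [DecidableEq α] (V : Set α) (r : ℕ)
    (F : Finset (Finset α)) : Prop :=
  ∃ i : ℕ, 2 ≤ i ∧ i ≤ 5 ∧
    ∃ X Y : Finset α, ↑X ⊆ V ∧ ↑Y ⊆ V ∧ X.card = 6 ∧ Disjoint X Y ∧ Y.card + i = r ∧
      (∀ A ⊆ X, A.card = i - 1 → Y ∪ A ∈ F) ∧
      (∀ A ⊆ X, A.card = i → Y ∪ A ∈ F)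

/-- Four distinct nonzero elements of `ZMod 5` have product `-1`. -/
lemma prod_eq_neg_one_of_injOn {β : Type*} (C : Finset β) (g : β → ZMod 5)
    (hC : C.card = 4) (h0 : ∀ v ∈ C, g v ≠ 0) (hg : Set.InjOn g C) :
    ∏ v ∈ C, g v = -1 := by
  classical
  have himage : C.image g = Finset.univ.erase 0 := by
    apply Finset.eq_of_subset_of_card_le
    · intro x hx
      obtain ⟨v, hv, rfl⟩ := Finset.mem_image.1 hx
      simp [h0 v hv]
    · rw [Finset.card_image_of_injOn hg, hC]
      decide
  have hprod := Finset.prod_image (s := C) (g := g) (f := fun x : ZMod 5 => x) hg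
  rw [← hprod, himage]
  decide

/-- There is no `m × (7 - m)` matrix over `ZMod 5`, for `m = 2` or `m = 3`, all of whose entries
and `2 × 2` minors are nonzero. -/
lemma false_of_minors_ne_zero_of_card_le {α β : Type*} (A : Finset α) (C : Finset β)
    (f : α → β → ZMod 5) (hA : 2 ≤ A.card) (hA' : A.card ≤ 3) (hAC : A.card + C.card = 7)
    (h1 : ∀ a ∈ A, ∀ v ∈ C, f a v ≠ 0)
    (h2 : ∀ a ∈ A, ∀ a' ∈ A, a ≠ a' → ∀ v ∈ C, ∀ v' ∈ C, v ≠ v' →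
      f a v * f a' v' ≠ f a v' * f a' v) : False := by
  classical
  have h4 : (Finset.univ.erase (0 : ZMod 5)).card = 4 := by decide
  have hneg : (-1 : ZMod 5) * -1 ≠ -1 := by decide
  have : Fact (Nat.Prime 5) := ⟨by norm_num⟩
  have hinj : ∀ a ∈ A, ∀ a' ∈ A, a ≠ a' → Set.InjOn (fun v => f a v / f a' v) C := by
    intro a ha a' ha' hne v hv v' hv' hvv
    by_contra hne'
    exact h2 a ha a' ha' hne v hv v' hv' hne'
      ((div_eq_div_iff (h1 a' ha' v hv) (h1 a' ha' v' hv')).1 hvv)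
  have hnz : ∀ a ∈ A, ∀ a' ∈ A, ∀ v ∈ C, f a v / f a' v ≠ 0 := fun a ha a' ha' v hv =>
    div_ne_zero (h1 a ha v hv) (h1 a' ha' v hv)
  obtain hcard | hcard : A.card = 2 ∨ A.card = 3 := by omega
  · obtain ⟨a, b, hab, rfl⟩ := Finset.card_eq_two.1 hcard
    have hle : C.card ≤ (Finset.univ.erase (0 : ZMod 5)).card := by
      refine Finset.card_le_card_of_injOn (fun v => f a v / f b v) ?_
        (hinj a (by simp) b (by simp) hab)
      intro v hv
      simpa using hnz a (by simp) b (by simp) v hv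
    omega
  · obtain ⟨a, b, c, hab, hac, hbc, rfl⟩ := Finset.card_eq_three.1 hcard
    have hC : C.card = 4 := by omega
    have e1 := prod_eq_neg_one_of_injOn C _ hC (hnz a (by simp) b (by simp))
      (hinj a (by simp) b (by simp) hab)
    have e2 := prod_eq_neg_one_of_injOn C _ hC (hnz b (by simp) c (by simp))
      (hinj b (by simp) c (by simp) hbc)
    have e3 := prod_eq_neg_one_of_injOn C _ hC (hnz a (by simp) c (by simp))
      (hinj a (by simp) c (by simp) hac)
    have hmul : (∏ v ∈ C, f a v / f b v) * ∏ v ∈ C, f b v / f c v = ∏ v ∈ C, f a v / f c v := by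
      rw [← Finset.prod_mul_distrib]
      exact Finset.prod_congr rfl fun v hv => div_mul_div_cancel₀ (h1 b (by simp) v hv)
    rw [e1, e2, e3] at hmul
    exact hneg hmul

/-- There is no `m × (7 - m)` matrix over `ZMod 5`, `2 ≤ m ≤ 5`, all of whose entries and
`2 × 2` minors are nonzero. -/
lemma false_of_minors_ne_zero {α β : Type*} (A : Finset α) (C : Finset β)
    (f : α → β → ZMod 5) (hA : 2 ≤ A.card) (hC : 2 ≤ C.card) (hAC : A.card + C.card = 7)
    (h1 : ∀ a ∈ A, ∀ v ∈ C, f a v ≠ 0)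
    (h2 : ∀ a ∈ A, ∀ a' ∈ A, a ≠ a' → ∀ v ∈ C, ∀ v' ∈ C, v ≠ v' →
      f a v * f a' v' ≠ f a v' * f a' v) : False := by
  obtain hle | hle : A.card ≤ 3 ∨ C.card ≤ 3 := by omega
  · exact false_of_minors_ne_zero_of_card_le A C f hA hle hAC h1 h2
  · refine false_of_minors_ne_zero_of_card_le C A (fun v a => f a v) hC hle (by omega)
      (fun v hv a ha => h1 a ha v hv) fun v hv v' hv' hvv a ha a' ha' haa h => ?_
    exact h2 a ha a' ha' haa v hv v' hv' hvv (by rw [h]; ring)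

/-- If the vectors of `W` are written in terms of `S`, and exchanging `D ⊆ S` for `W` gives a
linearly independent set, then the rows of the coefficient matrix on `W × D` are linearly
independent. -/
lemma eq_zero_of_linearIndepOn_exchange {K E : Type*} [Field K] [AddCommGroup E] [Module K E]
    [DecidableEq E] {S D W : Finset E} (hDS : D ⊆ S) (hSW : Disjoint S W) (c : E → E → K)
    (hc : ∀ v, ∑ x ∈ S, c v x • x = v)
    (hli : LinearIndepOn K id ((S \ D ∪ W : Finset E) : Set E)) (s : E → K)
    (hs : ∀ a ∈ D, ∑ v ∈ W, s v * c v a = 0) : ∀ v ∈ W, s v = 0 := by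
  intro v hv
  have hdisj : Disjoint (S \ D) W := hSW.mono_left Finset.sdiff_subset
  have key := linearIndepOn_finset_iff.1 hli
    (fun x => if x ∈ W then - s x else ∑ v ∈ W, s v * c v x) ?_ v (by simp [hv])
  · simpa [hv] using key
  rw [Finset.sum_union hdisj]
  have eW : ∑ x ∈ W, (if x ∈ W then - s x else ∑ v ∈ W, s v * c v x) • id x
      = - ∑ x ∈ W, s x • x := by
    rw [← Finset.sum_neg_distrib]
    exact Finset.sum_congr rfl fun x hx => by simp [hx]
  have eS : ∑ x ∈ S \ D, (if x ∈ W then - s x else ∑ v ∈ W, s v * c v x) • id x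
      = ∑ x ∈ S, (∑ v ∈ W, s v * c v x) • x := by
    rw [← Finset.sum_sdiff hDS, Finset.sum_eq_zero (s := D) fun x hx => by rw [hs x hx, zero_smul],
      add_zero]
    exact Finset.sum_congr rfl fun x hx => by simp [Finset.disjoint_left.1 hdisj hx]
  have eT : ∑ x ∈ S, (∑ v ∈ W, s v * c v x) • x = ∑ v ∈ W, s v • v := by
    simp_rw [Finset.sum_smul, mul_smul]
    rw [Finset.sum_comm]
    exact Finset.sum_congr rfl fun v _ => by rw [← Finset.smul_sum, hc]
  rw [eS, eT, eW, add_neg_cancel]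

/-- In a vector space over `ZMod 5`, there are no seven vectors such that any `i` of them form a
basis together with a fixed set `Y`, where `2 ≤ i ≤ 5`. -/
lemma false_of_seven_linearIndepOn {E : Type*} [AddCommGroup E] [Module (ZMod 5) E]
    [DecidableEq E] (Y Z : Finset E) (i : ℕ) (hi : 2 ≤ i) (hi' : i ≤ 5) (hZ : Z.card = 7)
    (hYZ : Disjoint Y Z)
    (hli : ∀ B ⊆ Z, B.card = i → LinearIndepOn (ZMod 5) id ((Y ∪ B : Finset E) : Set E))
    (hspan : ∃ A ⊆ Z, A.card = i ∧
      Submodule.span (ZMod 5) ((Y ∪ A : Finset E) : Set E) = ⊤) : False := by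
  have : Fact (Nat.Prime 5) := ⟨by norm_num⟩
  obtain ⟨A, hAZ, hA, htop⟩ := hspan
  have hex : ∀ v : E, ∃ c : E → ZMod 5, ∑ x ∈ Y ∪ A, c x • x = v := by
    intro v
    have hv : v ∈ Submodule.span (ZMod 5) ((Y ∪ A : Finset E) : Set E) := htop ▸ trivial
    obtain ⟨c, -, hc⟩ := Submodule.mem_span_finset.1 hv
    exact ⟨c, hc⟩
  choose c hc using hex
  have key : ∀ D ⊆ A, ∀ W ⊆ Z \ A, D.card = W.card → ∀ s : E → ZMod 5,
      (∀ a ∈ D, ∑ v ∈ W, s v * c v a = 0) → ∀ v ∈ W, s v = 0 := by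
    intro D hD W hW hDW s hs
    have hWZ : W ⊆ Z := hW.trans Finset.sdiff_subset
    have hAW : Disjoint A W := (Finset.disjoint_sdiff (s := A) (t := Z)).mono_right hW
    have hYA : Disjoint Y A := hYZ.mono_right hAZ
    refine eq_zero_of_linearIndepOn_exchange (hD.trans Finset.subset_union_right)
      (Finset.disjoint_union_left.2 ⟨hYZ.mono_right hWZ, hAW⟩) c hc ?_ s hs
    have heq : (Y ∪ A) \ D ∪ W = Y ∪ (A \ D ∪ W) := by
      rw [Finset.union_sdiff_distrib, Finset.sdiff_eq_self_of_disjoint (hYA.mono_right hD),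
        Finset.union_assoc]
    rw [heq]
    refine hli _ (Finset.union_subset (Finset.sdiff_subset.trans hAZ) hWZ) ?_
    rw [Finset.card_union_of_disjoint (hAW.mono_left Finset.sdiff_subset),
      Finset.card_sdiff_of_subset hD]
    have := Finset.card_le_card hD
    omega
  have hcard : (Z \ A).card = 7 - i := by rw [Finset.card_sdiff_of_subset hAZ, hZ, hA]
  have hne : ∀ a ∈ A, ∀ v ∈ Z \ A, c v a ≠ 0 := by
    intro a ha v hv h0
    have := key {a} (by simpa using ha) {v} (by simpa using hv) (by simp) (fun _ => 1)
      (by simpa using h0) v (by simp)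
    exact one_ne_zero this
  refine false_of_minors_ne_zero A (Z \ A) (fun a v => c v a) (by omega) (by omega) (by omega)
    hne ?_
  intro a ha a' ha' haa v hv v' hv' hvv h
  have := key {a, a'} (by simp [Finset.insert_subset_iff, ha, ha']) {v, v'}
    (Finset.insert_subset_iff.2 ⟨hv, Finset.singleton_subset_iff.2 hv'⟩)
    (by rw [Finset.card_pair haa, Finset.card_pair hvv])
    (fun x => if x = v then c v' a else - c v a) ?_ v (by simp)
  · exact hne a ha v' hv' (by simpa using this)
  · intro x hx
    rw [Finset.sum_pair hvv]
    simp only [Finset.mem_insert, Finset.mem_singleton] at hx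
    simp only [if_true, if_neg hvv.symm]
    rcases hx with rfl | rfl
    · ring
    · linear_combination -h

/-- Fix a nonzero `w ∈ F_5^r`. Let `F_1` be the family of all `r`-element subsets of
`F_5^r \ {0}` that are bases of `F_5^r`, and `F_2` the family of all `(r-1)`-element subsets
`B` of `F_5^r \ {0}` with `B ∪ {w}` a basis of `F_5^r`. Then `F_1 ∪ F_2` contains no copy of
two consecutive nontrivial layers of a `Q_6` on the ground set `F_5^r \ {0}`. -/
theorem bases_two_layers_free (r : ℕ) (hr : 1 ≤ r) (w : Fin r → ZMod 5) (hw : w ≠ 0)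
    (F₁ F₂ : Finset (Finset (Fin r → ZMod 5)))
    (hF₁ : ∀ A : Finset (Fin r → ZMod 5),
      A ∈ F₁ ↔ A.card = r ∧ (0 : Fin r → ZMod 5) ∉ A ∧
        LinearIndependent (ZMod 5) (fun x : (A : Set (Fin r → ZMod 5)) => (x : Fin r → ZMod 5)) ∧
        Submodule.span (ZMod 5) (A : Set (Fin r → ZMod 5)) = ⊤)
    (hF₂ : ∀ B : Finset (Fin r → ZMod 5),
      B ∈ F₂ ↔ B.card = r - 1 ∧ (0 : Fin r → ZMod 5) ∉ B ∧
        LinearIndependent (ZMod 5)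
          (fun x : (insert w B : Finset (Fin r → ZMod 5)) => (x : Fin r → ZMod 5)) ∧
        Submodule.span (ZMod 5) ((insert w B : Finset (Fin r → ZMod 5)) : Set (Fin r → ZMod 5)) = ⊤) :
    ¬ ContainsQ6LayersOn {v : Fin r → ZMod 5 | v ≠ 0} r (F₁ ∪ F₂) := by
  have : Fact (Nat.Prime 5) := ⟨by norm_num⟩
  rintro ⟨i, hi, hi', X, Y, -, -, hX, hXY, hYr, hlow, hhigh⟩
  have hbasis : ∀ A ⊆ X, A.card = i → LinearIndepOn (ZMod 5) id
      ((Y ∪ A : Finset (Fin r → ZMod 5)) : Set (Fin r → ZMod 5)) ∧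
      Submodule.span (ZMod 5) ((Y ∪ A : Finset (Fin r → ZMod 5)) : Set (Fin r → ZMod 5)) = ⊤ := by
    intro A hAX hA
    have hcard : (Y ∪ A).card = r := by
      rw [Finset.card_union_of_disjoint (hXY.symm.mono_right hAX)]
      omega
    rcases Finset.mem_union.1 (hhigh A hAX hA) with h | h
    · exact ⟨((hF₁ _).1 h).2.2.1, ((hF₁ _).1 h).2.2.2⟩
    · have := ((hF₂ _).1 h).1
      omega
  have hcobasis : ∀ A ⊆ X, A.card = i - 1 → w ∉ Y ∪ A ∧ LinearIndepOn (ZMod 5) id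
      ((insert w (Y ∪ A) : Finset (Fin r → ZMod 5)) : Set (Fin r → ZMod 5)) := by
    intro A hAX hA
    have hcard : (Y ∪ A).card = r - 1 := by
      rw [Finset.card_union_of_disjoint (hXY.symm.mono_right hAX)]
      omega
    rcases Finset.mem_union.1 (hlow A hAX hA) with h | h
    · have := ((hF₁ _).1 h).1
      omega
    · obtain ⟨-, -, hli, htop⟩ := (hF₂ _).1 h
      refine ⟨fun hw' => ?_, hli⟩
      rw [Finset.insert_eq_of_mem hw'] at htop
      have hle := finrank_span_finset_le_card (R := ZMod 5) (Y ∪ A)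
      rw [Set.finrank, htop, finrank_top, Module.finrank_fin_fun] at hle
      omega
  have hwX : w ∉ X := by
    intro hwX
    obtain ⟨A, hwA, hAX, hA⟩ := Finset.exists_subsuperset_card_eq
      (Finset.singleton_subset_iff.2 hwX) (n := i - 1) (by simp; omega) (by omega)
    exact (hcobasis A hAX hA).1 (Finset.mem_union_right _ (hwA (by simp)))
  have hwY : w ∉ Y := by
    intro hwY
    obtain ⟨A, hAX, hA⟩ := Finset.exists_subset_card_eq (s := X) (n := i - 1) (by omega)
    exact (hcobasis A hAX hA).1 (Finset.mem_union_left _ hwY)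
  obtain ⟨A, hAX, hA⟩ := Finset.exists_subset_card_eq (s := X) (n := i) (by omega)
  refine false_of_seven_linearIndepOn Y (insert w X) i hi hi'
    (by rw [Finset.card_insert_of_notMem hwX, hX])
    (Finset.disjoint_insert_right.2 ⟨hwY, hXY.symm⟩) ?_
    ⟨A, hAX.trans (Finset.subset_insert _ _), hA, (hbasis A hAX hA).2⟩
  intro B hB hBi
  by_cases hwB : w ∈ B
  · have h := (hcobasis (B.erase w) (Finset.subset_insert_iff.1 hB)
      (by rw [Finset.card_erase_of_mem hwB, hBi])).2
    rwa [← Finset.union_insert, Finset.insert_erase hwB] at h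
  · exact (hbasis B ((Finset.subset_insert_iff_of_notMem hwB).1 hB) hBi).1
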